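/- arXiv:2504.12155 — 4 statements merged into one kernel-verified Lean document; each statement's English description precedes it below -/
import Mathlib

section
/- Let M be a right R-module with a fixed chain of submodules 0 = M⁽⁰⁾ ≤ M⁽¹⁾ ≤ ... ≤ M⁽ⁿ⁾ = M, and let E_M be the ring of endomorphisms f of M with f(M⁽ⁱ⁾) ⊆ M⁽ⁱ⁾ for all i. Then the map φ : E_M → End(M⁽¹⁾/M⁽⁰⁾) × ... × End(M⁽ⁿ⁾/M⁽ⁿ⁻¹⁾) sending f to the tuple of induced endomorphisms of the factor modules is a local ring morphism. -/
universe u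

section Chains

variable {R : Type u} [Ring R]

/-- The `i`-th factor module `M⁽ⁱ⁺¹⁾/M⁽ⁱ⁾` of a chain of submodules
`c : Fin (n+1) → Submodule R M`. -/
abbrev ChainFactor {M : Type u} [AddCommGroup M] [Module R M] {n : ℕ}
    (c : Fin (n + 1) → Submodule R M) (i : Fin n) : Type u :=
  c i.succ ⧸ (Submodule.comap (c i.succ).subtype (c i.castSucc))

/-- A linear map `f : M → N` preserves the chains `c`, `d` if `f(c i) ⊆ d i` for all `i`. -/
def PreservesChain {M N : Type u} [AddCommGroup M] [Module R M] [AddCommGroup N]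
    [Module R N] {n : ℕ} (f : M →ₗ[R] N) (c : Fin (n + 1) → Submodule R M)
    (d : Fin (n + 1) → Submodule R N) : Prop :=
  ∀ i, ∀ x ∈ c i, f x ∈ d i

/-- The linear map induced on the `i`-th factor modules by a chain-preserving map. -/
def inducedHom {M N : Type u} [AddCommGroup M] [Module R M] [AddCommGroup N]
    [Module R N] {n : ℕ} {c : Fin (n + 1) → Submodule R M}
    {d : Fin (n + 1) → Submodule R N} (f : M →ₗ[R] N) (hf : PreservesChain f c d)
    (i : Fin n) : ChainFactor c i →ₗ[R] ChainFactor d i :=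
  Submodule.mapQ _ _ (f.restrict fun x hx => hf i.succ x hx)
    (fun x hx => hf i.castSucc x hx)

/-- The ring `E_M` of chain-preserving endomorphisms of `M`, as a subring of
`End(M)`. -/
def ChainEnd {M : Type u} [AddCommGroup M] [Module R M] {n : ℕ}
    (c : Fin (n + 1) → Submodule R M) : Subring (Module.End R M) where
  carrier := {f | ∀ i, ∀ x ∈ c i, f x ∈ c i}
  zero_mem' := by intro i x hx; simp
  one_mem' := by intro i x hx; simpa using hx
  add_mem' := by intro f g hf hg i x hx; simpa using (c i).add_mem (hf i x hx) (hg i x hx)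
  neg_mem' := by intro f hf i x hx; simpa using (c i).neg_mem (hf i x hx)
  mul_mem' := by intro f g hf hg i x hx; exact hf i _ (hg i x hx)

/-- The canonical map from `E_M` to the product of the endomorphism rings of the factor
modules, sending a chain endomorphism to the tuple of its induced endomorphisms. -/
def chainDiag {M : Type u} [AddCommGroup M] [Module R M] {n : ℕ}
    (c : Fin (n + 1) → Submodule R M) (f : ChainEnd c) (i : Fin n) :
    Module.End R (ChainFactor c i) :=
  inducedHom (f : Module.End R M) (fun j x hx => f.2 j x hx) i

end Chains

section Chains

variable {R : Type u} [Ring R] {M : Type u} [AddCommGroup M] [Module R M] {n : ℕ}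
  {c : Fin (n + 1) → Submodule R M}

theorem chainDiag_mk (f : ChainEnd c) (i : Fin n) (x : c i.succ) :
    chainDiag c f i (Submodule.Quotient.mk x) =
      Submodule.Quotient.mk ⟨f.1 x, f.2 i.succ x x.2⟩ :=
  rfl

theorem mem_of_chainDiag_injective {f : ChainEnd c} {i : Fin n}
    (hf : Function.Injective (chainDiag c f i)) {x : M} (hx : x ∈ c i.succ)
    (hfx : f.1 x ∈ c i.castSucc) : x ∈ c i.castSucc := by
  have h : (Submodule.Quotient.mk ⟨x, hx⟩ : ChainFactor c i) = 0 := by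
    apply hf
    rw [map_zero, chainDiag_mk, Submodule.Quotient.mk_eq_zero]
    exact hfx
  rwa [Submodule.Quotient.mk_eq_zero] at h

theorem exists_sub_mem_of_chainDiag_surjective {f : ChainEnd c} {i : Fin n}
    (hf : Function.Surjective (chainDiag c f i)) {y : M} (hy : y ∈ c i.succ) :
    ∃ x ∈ c i.succ, y - f.1 x ∈ c i.castSucc := by
  obtain ⟨q, hq⟩ := hf (Submodule.Quotient.mk ⟨y, hy⟩)
  obtain ⟨x, rfl⟩ := Submodule.Quotient.mk_surjective _ q
  rw [chainDiag_mk, eq_comm, Submodule.Quotient.eq] at hq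
  exact ⟨x, x.2, hq⟩

theorem eq_zero_of_forall_chainDiag_injective (h0 : c 0 = ⊥) {f : ChainEnd c}
    (hf : ∀ i, Function.Injective (chainDiag c f i)) (i : Fin (n + 1)) :
    ∀ x ∈ c i, f.1 x = 0 → x = 0 := by
  induction i using Fin.induction with
  | zero =>
    intro x hx _
    rwa [h0, Submodule.mem_bot] at hx
  | succ i ih =>
    intro x hx hfx
    exact ih x (mem_of_chainDiag_injective (hf i) hx (hfx ▸ zero_mem _)) hfx

theorem exists_apply_eq_of_forall_chainDiag_surjective (hmono : Monotone c) (h0 : c 0 = ⊥)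
    {f : ChainEnd c} (hf : ∀ i, Function.Surjective (chainDiag c f i)) (i : Fin (n + 1)) :
    ∀ y ∈ c i, ∃ x ∈ c i, f.1 x = y := by
  induction i using Fin.induction with
  | zero =>
    intro y hy
    rw [h0, Submodule.mem_bot] at hy
    exact ⟨0, zero_mem _, by rw [hy, map_zero]⟩
  | succ i ih =>
    intro y hy
    obtain ⟨x, hx, hxy⟩ := exists_sub_mem_of_chainDiag_surjective (hf i) hy
    obtain ⟨z, hz, hzy⟩ := ih _ hxy
    exact ⟨x + z, add_mem hx (hmono i.castSucc_le_succ hz), by rw [map_add, hzy, add_sub_cancel]⟩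

theorem ChainEnd.isUnit_of_injective {f : ChainEnd c} (hinj : Function.Injective f.1)
    (hsurj : ∀ i, ∀ y ∈ c i, ∃ x ∈ c i, f.1 x = y) (hn : c (Fin.last n) = ⊤) : IsUnit f := by
  have hbij : Function.Bijective f.1 := by
    refine ⟨hinj, fun y => ?_⟩
    obtain ⟨x, -, hx⟩ := hsurj (Fin.last n) y (hn ▸ Submodule.mem_top)
    exact ⟨x, hx⟩
  let e := LinearEquiv.ofBijective f.1 hbij
  let g : ChainEnd c := ⟨e.symm.toLinearMap, fun i y hy => by
    obtain ⟨x, hx, rfl⟩ := hsurj i y hy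
    have : e.symm (f.1 x) = x := e.symm_apply_apply x
    exact this.symm ▸ hx⟩
  refine ⟨⟨f, g, ?_, ?_⟩, rfl⟩
  · exact Subtype.ext (LinearMap.ext e.apply_symm_apply)
  · exact Subtype.ext (LinearMap.ext e.symm_apply_apply)

theorem isUnit_of_isUnit_chainDiag (hmono : Monotone c) (h0 : c 0 = ⊥)
    (hn : c (Fin.last n) = ⊤) {f : ChainEnd c} (hf : IsUnit (chainDiag c f)) : IsUnit f := by
  have hbij i : Function.Bijective (chainDiag c f i) :=
    (Module.End.isUnit_iff _).1 (Pi.isUnit_iff.1 hf i)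
  refine ChainEnd.isUnit_of_injective ?_
    (exists_apply_eq_of_forall_chainDiag_surjective hmono h0 fun i => (hbij i).2) hn
  exact (injective_iff_map_eq_zero f.1).2 fun x =>
    eq_zero_of_forall_chainDiag_injective h0 (fun i => (hbij i).1) (Fin.last n) x
      (hn ▸ Submodule.mem_top)

end Chains

/-- For a module `M` with a chain of submodules `0 = c 0 ≤ ... ≤ c n = M`, the canonical
map `φ : E_M → End(c 1/c 0) × ... × End(c n/c (n-1))` sending a chain endomorphism to
the tuple of its induced endomorphisms is a local ring morphism: it preserves `1`,
multiplication and addition, and whenever `φ f` is invertible, `f` is invertible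
in `E_M`. -/
theorem chainDiag_is_local_ring_morphism
    {R : Type u} [Ring R] {M : Type u} [AddCommGroup M] [Module R M] {n : ℕ}
    (c : Fin (n + 1) → Submodule R M) (hmono : Monotone c)
    (h0 : c 0 = ⊥) (hn : c (Fin.last n) = ⊤) :
    chainDiag c 1 = 1 ∧
    (∀ f g : ChainEnd c, chainDiag c (f * g) = chainDiag c f * chainDiag c g) ∧
    (∀ f g : ChainEnd c, chainDiag c (f + g) = chainDiag c f + chainDiag c g) ∧
    (∀ f : ChainEnd c, IsUnit (chainDiag c f) → IsUnit f) := by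
  refine ⟨?_, fun f g => ?_, fun f g => ?_, fun f => isUnit_of_isUnit_chainDiag hmono h0 hn⟩
  all_goals
    funext i
    refine LinearMap.ext fun q => ?_
    obtain ⟨x, rfl⟩ := Submodule.Quotient.mk_surjective _ q
    rfl
end

section
/- Let M be a right R-module with a chain 0 = M⁽⁰⁾ ≤ ... ≤ M⁽ⁿ⁾ = M whose factor modules U⁽ⁱ⁾ = M⁽ⁱ⁾/M⁽ⁱ⁻¹⁾ are all non-zero uniserial. Then E_M/J(E_M) is isomorphic to a direct product of at most 2n division rings. -/
universe u

/-- A module is uniserial if its lattice of submodules is linearly ordered by inclusion. -/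
def IsUniserialModule (R M : Type*) [Ring R] [AddCommGroup M] [Module R M] : Prop :=
  ∀ A B : Submodule R M, A ≤ B ∨ B ≤ A

namespace Ideal

variable {A : Type*} [Ring A]

/-- A left ideal `L` and finitely many two-sided ideals, none of them contained in a completely
prime ideal `Q`, have a common element outside `Q`. -/
theorem exists_mem_forall_mem_notMem {ι : Type*} (P : ι → Ideal A) [∀ i, (P i).IsTwoSided]
    {L Q : Ideal A} (hQ : Q.IsPrime) (hL : ¬ L ≤ Q) (s : Finset ι) (hs : ∀ i ∈ s, ¬ P i ≤ Q) :
    ∃ y ∈ L, y ∉ Q ∧ ∀ i ∈ s, y ∈ P i := by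
  classical
  induction s using Finset.induction_on with
  | empty =>
    obtain ⟨y, hyL, hyQ⟩ := SetLike.not_le_iff_exists.mp hL
    exact ⟨y, hyL, hyQ, by simp⟩
  | insert a s ha ih =>
    obtain ⟨y, hyL, hyQ, hys⟩ := ih fun i hi => hs i (Finset.mem_insert_of_mem hi)
    obtain ⟨p, hpa, hpQ⟩ := SetLike.not_le_iff_exists.mp (hs a (Finset.mem_insert_self a s))
    refine ⟨p * y, L.mul_mem_left p hyL, hQ.mul_notMem hpQ hyQ, fun i hi => ?_⟩
    obtain rfl | hi := Finset.mem_insert.mp hi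
    · exact (P i).mul_mem_right y hpa
    · exact (P i).mul_mem_left p (hys i hi)

/-- Prime avoidance for a left ideal and finitely many completely prime two-sided ideals. -/
theorem exists_mem_forall_notMem_of_isPrime {ι : Type*} (P : ι → Ideal A)
    [∀ i, (P i).IsTwoSided] (hP : ∀ i, (P i).IsPrime) {L : Ideal A} (s : Finset ι)
    (hL : ∀ i ∈ s, ¬ L ≤ P i) : ∃ x ∈ L, ∀ i ∈ s, x ∉ P i := by
  classical
  induction s using Finset.strongInduction with
  | H s ih =>
    obtain rfl | ⟨a, ha⟩ := s.eq_empty_or_nonempty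
    · exact ⟨0, L.zero_mem, by simp⟩
    by_cases hle : ∃ i ∈ s, ∃ j ∈ s, i ≠ j ∧ P i ≤ P j
    · obtain ⟨i, hi, j, hj, hij, hPij⟩ := hle
      obtain ⟨x, hxL, hx⟩ := ih (s.erase i) (Finset.erase_ssubset hi)
        fun k hk => hL k (Finset.mem_of_mem_erase hk)
      refine ⟨x, hxL, fun k hk => ?_⟩
      obtain rfl | hki := eq_or_ne k i
      · exact fun hxk => hx j (Finset.mem_erase.mpr ⟨hij.symm, hj⟩) (hPij hxk)
      · exact hx k (Finset.mem_erase.mpr ⟨hki, hk⟩)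
    · push Not at hle
      obtain ⟨x, hxL, hx⟩ := ih (s.erase a) (Finset.erase_ssubset ha)
        fun k hk => hL k (Finset.mem_of_mem_erase hk)
      by_cases hxa : x ∈ P a
      · obtain ⟨y, hyL, hya, hy⟩ := exists_mem_forall_mem_notMem P (hP a) (hL a ha) (s.erase a)
          fun i hi => hle i (Finset.mem_of_mem_erase hi) a ha (Finset.ne_of_mem_erase hi)
        refine ⟨x + y, L.add_mem hxL hyL, fun k hk => ?_⟩
        obtain rfl | hka := eq_or_ne k a
        · rwa [(P k).add_mem_iff_right hxa]
        · have hk' := Finset.mem_erase.mpr ⟨hka, hk⟩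
          rw [(P k).add_mem_iff_left (hy k hk')]
          exact hx k hk'
      · refine ⟨x, hxL, fun k hk => ?_⟩
        obtain rfl | hka := eq_or_ne k a
        · exact hxa
        · exact hx k (Finset.mem_erase.mpr ⟨hka, hk⟩)

/-- If every non-unit lies in one of finitely many completely prime two-sided ideals, then every
maximal left ideal is one of them. -/
theorem IsMaximal.mem_range_of_forall_isUnit {ι : Type*} [Finite ι] (P : ι → Ideal A)
    [∀ i, (P i).IsTwoSided] (hP : ∀ i, (P i).IsPrime)
    (hunit : ∀ x, (∀ i, x ∉ P i) → IsUnit x) {L : Ideal A} (hL : L.IsMaximal) :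
    L ∈ Set.range P := by
  cases nonempty_fintype ι
  by_contra hrange
  obtain ⟨x, hxL, hx⟩ := exists_mem_forall_notMem_of_isPrime P hP (L := L) Finset.univ
    fun i _ hi => hrange ⟨i, (hL.eq_of_le (hP i).ne_top hi).symm⟩
  exact hL.ne_top (L.eq_top_of_isUnit_mem hxL (hunit x fun i => hx i (Finset.mem_univ i)))

/-- An element outside a maximal left ideal is left invertible modulo that ideal. -/
theorem IsMaximal.exists_mul_sub_one_mem {P : Ideal A} (hP : P.IsMaximal) {x : A} (hx : x ∉ P) :
    ∃ y, y * x - 1 ∈ P := by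
  obtain ⟨y, z, hz, h⟩ := hP.exists_inv hx
  exact ⟨y, by rw [← h]; simpa using hz⟩

/-- The quotient of a ring by a two-sided ideal that is maximal as a left ideal is a division
ring. -/
noncomputable abbrev Quotient.divisionRingOfIsTwoSided (P : Ideal A) [P.IsTwoSided]
    (hP : P.IsMaximal) : DivisionRing (A ⧸ P) :=
  haveI : Nontrivial (A ⧸ P) := Ideal.Quotient.nontrivial_iff.mpr hP.ne_top
  DivisionRing.ofIsUnitOrEqZero <| by
    have left_inv : ∀ a : A ⧸ P, a ≠ 0 → ∃ b, b * a = 1 := by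
      intro a ha
      obtain ⟨x, rfl⟩ := Ideal.Quotient.mk_surjective a
      obtain ⟨y, hy⟩ := hP.exists_mul_sub_one_mem
        (mt (Ideal.Quotient.eq_zero_iff_mem (I := P)).mpr ha)
      exact ⟨Ideal.Quotient.mk P y, by
        rw [← map_mul, ← map_one (Ideal.Quotient.mk P)]; exact Ideal.Quotient.eq.mpr hy⟩
    intro a
    refine or_iff_not_imp_right.mpr fun ha => ?_
    obtain ⟨b, hba⟩ := left_inv a ha
    have hb : b ≠ 0 := by rintro rfl; simp at hba
    obtain ⟨d, hdb⟩ := left_inv b hb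
    have hda : d = a := left_inv_eq_right_inv hdb hba
    exact ⟨⟨a, b, hda ▸ hdb, hba⟩, rfl⟩

/-- The Chinese remainder theorem for finitely many distinct completely prime two-sided ideals
that are maximal as left ideals. -/
theorem pi_mk_surjective_of_isMaximal {ι : Type*} [Finite ι] {P : ι → Ideal A}
    [∀ i, (P i).IsTwoSided] (hP : ∀ i, (P i).IsPrime) (hmax : ∀ i, (P i).IsMaximal)
    (hinj : Function.Injective P) :
    Function.Surjective (RingHom.pi fun i => Ideal.Quotient.mk (P i)) := by
  classical
  cases nonempty_fintype ι
  have hidem : ∀ i, ∃ e, e - 1 ∈ P i ∧ ∀ j, j ≠ i → e ∈ P j := by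
    intro i
    obtain ⟨y, -, hyi, hy⟩ := exists_mem_forall_mem_notMem P (L := ⊤) (hP i)
      (fun h => (hP i).ne_top (top_le_iff.mp h)) (Finset.univ.erase i) fun j hj hle =>
        Finset.ne_of_mem_erase hj (hinj ((hmax j).eq_of_le (hP i).ne_top hle))
    obtain ⟨z, hz⟩ := (hmax i).exists_mul_sub_one_mem hyi
    exact ⟨z * y, hz, fun j hj => (P j).mul_mem_left z (hy j (by simp [hj]))⟩
  choose e he1 he0 using hidem
  intro x
  choose r hr using fun i => Ideal.Quotient.mk_surjective (x i)
  refine ⟨∑ i, r i * e i, funext fun j => ?_⟩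
  rw [RingHom.pi_apply, map_sum, Finset.sum_eq_single j]
  · have h1 : Ideal.Quotient.mk (P j) (e j) = 1 := by
      rw [← map_one (Ideal.Quotient.mk (P j))]; exact Ideal.Quotient.eq.mpr (he1 j)
    rw [map_mul, h1, mul_one, hr]
  · intro i _ hij
    rw [map_mul, Ideal.Quotient.eq_zero_iff_mem.mpr (he0 i j hij.symm), mul_zero]
  · simp

end Ideal

/-- If the non-units of a ring `A` are covered by finitely many completely prime two-sided ideals,
then `A` modulo its Jacobson radical is a product of at most that many division rings. -/
theorem exists_surjective_pi_divisionRing_of_isPrime_cover {A : Type u} [Ring A] {ι : Type*}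
    [Finite ι] (P : ι → Ideal A) [∀ i, (P i).IsTwoSided] (hP : ∀ i, (P i).IsPrime)
    (hunit : ∀ x, (∀ i, x ∉ P i) → IsUnit x) :
    ∃ (k : ℕ), k ≤ Nat.card ι ∧ ∃ (D : Fin k → Type u) (_ : ∀ j, DivisionRing (D j))
      (π : A →+* ∀ j, D j), Function.Surjective π ∧
        (RingHom.ker π : Set A) = ((⊥ : Ideal A).jacobson : Set A) := by
  have hmem : ∀ L : {L : Ideal A // L.IsMaximal}, ∃ i, P i = L :=
    fun L => L.2.mem_range_of_forall_isUnit P hP hunit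
  choose g hg using hmem
  have hginj : Function.Injective g := fun L L' h => Subtype.ext (by rw [← hg, ← hg, h])
  have : Finite {L : Ideal A // L.IsMaximal} := Finite.of_injective g hginj
  let m := (Finite.equivFin {L : Ideal A // L.IsMaximal}).symm
  let Q : Fin (Nat.card {L : Ideal A // L.IsMaximal}) → Ideal A := fun j => P (g (m j))
  have hQ : ∀ j, Q j = m j := fun j => hg (m j)
  have hmax : ∀ j, (Q j).IsMaximal := fun j => hQ j ▸ (m j).2
  have hQinj : Function.Injective Q := fun i j h =>
    m.injective (Subtype.ext (by rw [← hQ, ← hQ, h]))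
  refine ⟨_, Nat.card_le_card_of_injective g hginj, fun j => A ⧸ Q j,
    fun j => Ideal.Quotient.divisionRingOfIsTwoSided (Q j) (hmax j),
    RingHom.pi fun j => Ideal.Quotient.mk (Q j),
    Ideal.pi_mk_surjective_of_isMaximal (fun j => hP _) hmax hQinj, ?_⟩
  ext x
  rw [SetLike.mem_coe, SetLike.mem_coe, RingHom.mem_ker, Ideal.jacobson, Ideal.mem_sInf]
  constructor
  · rintro hx L ⟨-, hL⟩
    have h := Ideal.Quotient.eq_zero_iff_mem.mp (congrFun hx (m.symm ⟨L, hL⟩))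
    rwa [hQ, Equiv.apply_symm_apply] at h
  · intro hx
    exact funext fun j => Ideal.Quotient.eq_zero_iff_mem.mpr (hx ⟨bot_le, hmax j⟩)

namespace IsUniserialModule

variable {R U : Type*} [Ring R] [AddCommGroup U] [Module R U]

theorem inf_ne_bot (h : IsUniserialModule R U) {A B : Submodule R U} (hA : A ≠ ⊥) (hB : B ≠ ⊥) :
    A ⊓ B ≠ ⊥ := by
  rcases h A B with h | h
  · rwa [inf_eq_left.mpr h]
  · rwa [inf_eq_right.mpr h]

theorem sup_ne_top (h : IsUniserialModule R U) {A B : Submodule R U} (hA : A ≠ ⊤) (hB : B ≠ ⊤) :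
    A ⊔ B ≠ ⊤ := by
  rcases h A B with h | h
  · rwa [sup_eq_right.mpr h]
  · rwa [sup_eq_left.mpr h]

variable [Nontrivial U]

/-- The ideal of non-injective endomorphisms of a nonzero uniserial module. -/
def nonInjective (h : IsUniserialModule R U) : Ideal (Module.End R U) where
  carrier := {f | LinearMap.ker f ≠ ⊥}
  zero_mem' := by
    rw [Set.mem_ofPred_eq, LinearMap.ker_zero]
    exact top_ne_bot
  add_mem' {f g} hf hg := by
    refine ne_bot_of_le_ne_bot (h.inf_ne_bot hf hg) fun x hx => ?_
    have hfx : f x = 0 := hx.1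
    have hgx : g x = 0 := hx.2
    simp [hfx, hgx]
  smul_mem' a f hf := ne_bot_of_le_ne_bot hf (LinearMap.ker_le_ker_comp f a)

/-- The ideal of non-surjective endomorphisms of a nonzero uniserial module. -/
def nonSurjective (h : IsUniserialModule R U) : Ideal (Module.End R U) where
  carrier := {f | LinearMap.range f ≠ ⊤}
  zero_mem' := by
    rw [Set.mem_ofPred_eq, LinearMap.range_zero]
    exact bot_ne_top
  add_mem' {f g} hf hg := by
    refine ne_top_of_le_ne_top (h.sup_ne_top hf hg) ?_
    rintro _ ⟨x, rfl⟩
    exact Submodule.add_mem_sup (LinearMap.mem_range_self f x) (LinearMap.mem_range_self g x)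
  smul_mem' a f hf := by
    intro haf
    have ha : LinearMap.ker a ≠ ⊤ := by
      intro ha
      rw [LinearMap.ker_eq_top.mp ha, zero_smul, LinearMap.range_zero] at haf
      exact bot_ne_top haf
    refine h.sup_ne_top hf ha (eq_top_iff.mpr fun x _ => ?_)
    obtain ⟨y, hy⟩ : a x ∈ LinearMap.range (a • f) := haf ▸ Submodule.mem_top
    refine Submodule.mem_sup.mpr ⟨f y, LinearMap.mem_range_self f y, x - f y, ?_, by abel⟩
    have hy : a (f y) = a x := hy
    rw [LinearMap.mem_ker, map_sub, hy, sub_self]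

theorem mem_nonInjective (h : IsUniserialModule R U) {f : Module.End R U} :
    f ∈ h.nonInjective ↔ ¬ Function.Injective f :=
  LinearMap.ker_eq_bot.not

theorem mem_nonSurjective (h : IsUniserialModule R U) {f : Module.End R U} :
    f ∈ h.nonSurjective ↔ ¬ Function.Surjective f :=
  LinearMap.range_eq_top.not

instance (h : IsUniserialModule R U) : h.nonInjective.IsTwoSided where
  mul_mem_of_left {f} a hf := by
    by_cases ha : LinearMap.range a = ⊥
    · rw [LinearMap.range_eq_bot.mp ha, mul_zero]
      exact Ideal.zero_mem _
    · obtain ⟨_, ⟨⟨y, rfl⟩, hy⟩, hne⟩ := Submodule.exists_mem_ne_zero_of_ne_bot (h.inf_ne_bot ha hf)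
      refine (Submodule.ne_bot_iff _).mpr ⟨y, hy, ?_⟩
      rintro rfl
      exact hne (map_zero a)

instance (h : IsUniserialModule R U) : h.nonSurjective.IsTwoSided where
  mul_mem_of_left {f} a hf := ne_top_of_le_ne_top hf (LinearMap.range_comp_le_range a f)

theorem isPrime_nonInjective (h : IsUniserialModule R U) : h.nonInjective.IsPrime where
  ne_top' := by
    rw [Ideal.ne_top_iff_one, mem_nonInjective, not_not]
    exact Function.injective_id
  mem_or_mem' {f g} hfg := by
    rw [mem_nonInjective] at *
    rw [mem_nonInjective]
    by_contra! hinj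
    exact hfg (hinj.1.comp hinj.2)

theorem isPrime_nonSurjective (h : IsUniserialModule R U) : h.nonSurjective.IsPrime where
  ne_top' := by
    rw [Ideal.ne_top_iff_one, mem_nonSurjective, not_not]
    exact Function.surjective_id
  mem_or_mem' {f g} hfg := by
    rw [mem_nonSurjective] at *
    rw [mem_nonSurjective]
    by_contra! hsurj
    exact hfg (hsurj.1.comp hsurj.2)

end IsUniserialModule

section Chains

variable {R : Type u} [Ring R] {M : Type u} [AddCommGroup M] [Module R M] {n : ℕ}

/-- `chainDiag` in a fixed degree, as a ring homomorphism. -/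
def chainDiagHom (c : Fin (n + 1) → Submodule R M) (i : Fin n) :
    ChainEnd c →+* Module.End R (ChainFactor c i) where
  toFun f := chainDiag c f i
  map_one' := LinearMap.ext fun x => by induction x using Submodule.Quotient.induction_on; rfl
  map_mul' _ _ := LinearMap.ext fun x => by
    induction x using Submodule.Quotient.induction_on; rfl
  map_zero' := LinearMap.ext fun x => by induction x using Submodule.Quotient.induction_on; rfl
  map_add' _ _ := LinearMap.ext fun x => by
    induction x using Submodule.Quotient.induction_on; rfl

/-- A chain endomorphism inducing automorphisms on all factors restricts to an automorphism of
each member of the chain. -/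
theorem bijOn_of_bijective_chainDiag (c : Fin (n + 1) → Submodule R M) (hmono : Monotone c)
    (h0 : c 0 = ⊥) (f : ChainEnd c) (hf : ∀ i, Function.Bijective (chainDiag c f i))
    (i : Fin (n + 1)) : Set.BijOn (f : Module.End R M) (c i) (c i) := by
  refine ⟨f.2 i, ?_⟩
  induction i using Fin.induction with
  | zero =>
    rw [h0]
    refine ⟨by simp, fun y hy => ⟨0, Submodule.zero_mem _, ?_⟩⟩
    rw [map_zero, (Submodule.mem_bot R).mp hy]
  | succ i ih =>
    let q := (Submodule.comap (c i.succ).subtype (c i.castSucc)).mkQ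
    have hq : ∀ x : c i.succ, q x = 0 ↔ (x : M) ∈ c i.castSucc := fun x =>
      Submodule.Quotient.mk_eq_zero _
    constructor
    · rw [Set.injOn_iff_map_eq_zero]
      intro x hx hfx
      have hzero : chainDiag c f i (q ⟨x, hx⟩) = 0 :=
        (hq ⟨f.1 x, f.2 _ x hx⟩).mpr (by simp [hfx])
      have hx' : x ∈ c i.castSucc :=
        (hq ⟨x, hx⟩).mp ((hf i).1 (hzero.trans (map_zero _).symm))
      exact ih.1 hx' (Submodule.zero_mem _) (hfx.trans (map_zero _).symm)
    · intro y hy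
      obtain ⟨x, hx⟩ := (hf i).2 (q ⟨y, hy⟩)
      obtain ⟨x, rfl⟩ := Submodule.mkQ_surjective _ x
      have hsub : y - f.1 x ∈ c i.castSucc :=
        (hq (⟨y, hy⟩ - ⟨f.1 x, f.2 _ x x.2⟩)).mp (by rw [map_sub, ← hx]; exact sub_self _)
      obtain ⟨z, hz, hfz⟩ := ih.2 hsub
      refine ⟨x + z, Submodule.add_mem _ x.2 (hmono i.castSucc_le_succ hz), ?_⟩
      rw [map_add, hfz]
      exact add_sub_cancel _ _

/-- A chain endomorphism inducing automorphisms on all factors is invertible. -/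
theorem isUnit_of_bijective_chainDiag (c : Fin (n + 1) → Submodule R M) (hmono : Monotone c)
    (h0 : c 0 = ⊥) (hn : c (Fin.last n) = ⊤) (f : ChainEnd c)
    (hf : ∀ i, Function.Bijective (chainDiag c f i)) : IsUnit f := by
  have hbij := bijOn_of_bijective_chainDiag c hmono h0 f hf
  have hb : Function.Bijective (f : Module.End R M) := by
    have h := hbij (Fin.last n)
    rwa [hn, Submodule.top_coe, Set.bijOn_univ] at h
  let e := LinearEquiv.ofBijective (f : Module.End R M) hb
  have hmem : (e.symm : Module.End R M) ∈ ChainEnd c := by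
    intro i x hx
    obtain ⟨y, hy, rfl⟩ := (hbij i).surjOn hx
    exact (e.symm_apply_apply y).symm ▸ hy
  exact ⟨⟨f, ⟨_, hmem⟩, Subtype.ext (LinearMap.ext e.apply_symm_apply),
    Subtype.ext (LinearMap.ext e.symm_apply_apply)⟩, rfl⟩

end Chains

/-- If `M` has a chain of submodules `0 = c 0 ≤ ... ≤ c n = M` whose factor modules are
all non-zero uniserial, then `E_M/J(E_M)` is isomorphic to a direct product of at most
`2n` division rings: there are `k ≤ 2n` division rings and a surjective ring
homomorphism from `E_M` onto their product with kernel the Jacobson radical of `E_M`. -/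
theorem chainEnd_quotient_jacobson_isomorphic_product_divisionRings
    {R : Type u} [Ring R] {M : Type u} [AddCommGroup M] [Module R M] {n : ℕ}
    (c : Fin (n + 1) → Submodule R M) (hmono : Monotone c)
    (h0 : c 0 = ⊥) (hn : c (Fin.last n) = ⊤)
    (hnz : ∀ i : Fin n, Nontrivial (ChainFactor c i))
    (huni : ∀ i : Fin n, IsUniserialModule R (ChainFactor c i)) :
    ∃ (k : ℕ), k ≤ 2 * n ∧ ∃ (D : Fin k → Type u) (_ : ∀ j, DivisionRing (D j))
      (π : (ChainEnd c) →+* ∀ j, D j), Function.Surjective π ∧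
        (RingHom.ker π : Set (ChainEnd c)) =
          ((⊥ : Ideal (ChainEnd c)).jacobson : Set (ChainEnd c)) := by
  let P : Fin n ⊕ Fin n → Ideal (ChainEnd c) := Sum.elim
    (fun i => (huni i).nonInjective.comap (chainDiagHom c i))
    (fun i => (huni i).nonSurjective.comap (chainDiagHom c i))
  have : ∀ i, (P i).IsTwoSided := by
    rintro (i | i)
    exacts [inferInstanceAs ((huni i).nonInjective.comap (chainDiagHom c i)).IsTwoSided,
      inferInstanceAs ((huni i).nonSurjective.comap (chainDiagHom c i)).IsTwoSided]
  have hP : ∀ i, (P i).IsPrime := by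
    rintro (i | i)
    exacts [(huni i).isPrime_nonInjective.comap _, (huni i).isPrime_nonSurjective.comap _]
  obtain ⟨k, hk, h⟩ := exists_surjective_pi_divisionRing_of_isPrime_cover P hP fun f hf =>
    isUnit_of_bijective_chainDiag c hmono h0 hn f fun i =>
      ⟨not_not.mp ((huni i).mem_nonInjective.not.mp (hf (Sum.inl i))),
        not_not.mp ((huni i).mem_nonSurjective.not.mp (hf (Sum.inr i)))⟩
  refine ⟨k, hk.trans_eq ?_, h⟩
  rw [Nat.card_sum, Nat.card_fin, two_mul]
end

section
/- Let M be a right R-module with a chain 0 = M⁽⁰⁾ ≤ ... ≤ M⁽ⁿ⁾ = M whose factors U⁽ⁱ⁾ are all non-zero uniserial modules. For each i, let I_{M,i,m} = {f ∈ E_M : f_i not injective} and I_{M,i,e} = {f ∈ E_M : f_i not surjective}, where f_i is the endomorphism induced on U⁽ⁱ⁾. Then these 2n sets are two-sided completely prime ideals of E_M, and every proper right ideal and every proper left ideal of E_M is contained in one of them. -/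
universe u

/-- A completely prime two-sided ideal, as a set. -/
def IsCompletelyPrimeIdealSet {S : Type*} [Ring S] (P : Set S) : Prop :=
  (0 : S) ∈ P ∧ (∀ x ∈ P, ∀ y ∈ P, x + y ∈ P) ∧
  (∀ x ∈ P, ∀ s : S, s * x ∈ P) ∧ (∀ x ∈ P, ∀ s : S, x * s ∈ P) ∧
  P ≠ Set.univ ∧ ∀ x y : S, x * y ∈ P → x ∈ P ∨ y ∈ P

/-- A right ideal, as a set. -/
def IsRightIdealSet {S : Type*} [Ring S] (I : Set S) : Prop :=
  (0 : S) ∈ I ∧ (∀ x ∈ I, ∀ y ∈ I, x + y ∈ I) ∧ ∀ x ∈ I, ∀ s : S, x * s ∈ I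

/-- A left ideal, as a set. -/
def IsLeftIdealSet {S : Type*} [Ring S] (I : Set S) : Prop :=
  (0 : S) ∈ I ∧ (∀ x ∈ I, ∀ y ∈ I, x + y ∈ I) ∧ ∀ x ∈ I, ∀ s : S, s * x ∈ I

section Uniserial

variable {R U : Type*} [Ring R] [AddCommGroup U] [Module R U]

/-- The non-injective endomorphisms of a non-zero uniserial module form a completely prime
ideal. -/
theorem IsUniserialModule.isCompletelyPrimeIdealSet_not_injective [Nontrivial U]
    (hU : IsUniserialModule R U) :
    IsCompletelyPrimeIdealSet {f : Module.End R U | ¬Function.Injective f} := by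
  refine ⟨?_, ?_, ?_, ?_, ?_, ?_⟩
  · intro h
    obtain ⟨a, b, hab⟩ := exists_pair_ne U
    exact hab (h rfl)
  · intro x hx y hy hxy
    simp only [Set.mem_ofPred_eq, ← LinearMap.ker_eq_bot] at hx hy hxy
    rcases hU (LinearMap.ker x) (LinearMap.ker y) with h | h
    · refine hx (le_bot_iff.1 fun a ha => hxy ▸ ?_)
      have h₁ : x a = 0 := ha
      have h₂ : y a = 0 := h ha
      simp [h₁, h₂]
    · refine hy (le_bot_iff.1 fun a ha => hxy ▸ ?_)
      have h₁ : y a = 0 := ha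
      have h₂ : x a = 0 := h ha
      simp [h₁, h₂]
  · intro x hx s h
    exact hx (Function.Injective.of_comp (f := s) h)
  · intro x hx s h
    rcases hU (LinearMap.range s) (LinearMap.ker x) with hle | hle
    · obtain ⟨a, ha⟩ := exists_ne (0 : U)
      refine ha (h ?_)
      rw [map_zero]
      exact hle ⟨a, rfl⟩
    · refine hx ((injective_iff_map_eq_zero x).2 fun a ha => ?_)
      obtain ⟨b, rfl⟩ := hle ha
      rw [(map_eq_zero_iff (x * s) h).1 ha, map_zero]
  · intro h
    have : (1 : Module.End R U) ∈ {f : Module.End R U | ¬Function.Injective f} :=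
      h ▸ Set.mem_univ _
    exact this Function.injective_id
  · intro x y h
    by_contra! hxy
    simp only [Set.mem_ofPred_eq, not_not] at hxy
    exact h (hxy.1.comp hxy.2)

/-- The non-surjective endomorphisms of a non-zero uniserial module form a completely prime
ideal. -/
theorem IsUniserialModule.isCompletelyPrimeIdealSet_not_surjective [Nontrivial U]
    (hU : IsUniserialModule R U) :
    IsCompletelyPrimeIdealSet {f : Module.End R U | ¬Function.Surjective f} := by
  refine ⟨?_, ?_, ?_, ?_, ?_, ?_⟩
  · intro h
    obtain ⟨a, ha⟩ := exists_ne (0 : U)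
    obtain ⟨b, hb⟩ := h a
    exact ha hb.symm
  · intro x hx y hy hxy
    simp only [Set.mem_ofPred_eq, ← LinearMap.range_eq_top] at hx hy hxy
    rcases hU (LinearMap.range x) (LinearMap.range y) with h | h
    · refine hy (top_le_iff.1 (hxy ▸ ?_))
      rintro _ ⟨a, rfl⟩
      exact add_mem (h ⟨a, rfl⟩) ⟨a, rfl⟩
    · refine hx (top_le_iff.1 (hxy ▸ ?_))
      rintro _ ⟨a, rfl⟩
      exact add_mem ⟨a, rfl⟩ (h ⟨a, rfl⟩)
  · intro x hx s h
    rcases hU (LinearMap.range x) (LinearMap.ker s) with hle | hle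
    · obtain ⟨a, ha⟩ := exists_ne (0 : U)
      obtain ⟨b, hb⟩ := h a
      exact ha (hb.symm.trans (hle ⟨b, rfl⟩))
    · refine hx fun a => ?_
      obtain ⟨b, hb⟩ := h (s a)
      have hk : a - x b ∈ LinearMap.ker s := by
        rw [LinearMap.mem_ker, map_sub, sub_eq_zero]
        exact hb.symm
      obtain ⟨d, hd⟩ := hle hk
      exact ⟨d + b, by rw [map_add, hd, sub_add_cancel]⟩
  · intro x hx s h
    exact hx (Function.Surjective.of_comp (g := s) h)
  · intro h
    have : (1 : Module.End R U) ∈ {f : Module.End R U | ¬Function.Surjective f} :=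
      h ▸ Set.mem_univ _
    exact this Function.surjective_id
  · intro x y h
    by_contra! hxy
    simp only [Set.mem_ofPred_eq, not_not] at hxy
    exact h (hxy.1.comp hxy.2)

end Uniserial

section CompletelyPrime

variable {S T : Type*} [Ring S] [Ring T]

theorem IsCompletelyPrimeIdealSet.preimage {P : Set T} (hP : IsCompletelyPrimeIdealSet P)
    (φ : S →+* T) : IsCompletelyPrimeIdealSet (φ ⁻¹' P) := by
  obtain ⟨h_zero, h_add, h_left, h_right, h_ne, h_prime⟩ := hP
  refine ⟨?_, ?_, ?_, ?_, ?_, ?_⟩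
  · simpa using h_zero
  · intro x hx y hy
    simpa using h_add _ hx _ hy
  · intro x hx s
    simpa using h_left _ hx (φ s)
  · intro x hx s
    simpa using h_right _ hx (φ s)
  · intro h
    have h_one : φ 1 ∈ P := (Set.eq_univ_iff_forall.1 h) 1
    refine h_ne (Set.eq_univ_of_forall fun t => ?_)
    simpa using h_left _ h_one t
  · intro x y h
    exact h_prime _ _ (by simpa using h)

theorem IsCompletelyPrimeIdealSet.add_notMem {P : Set S} (hP : IsCompletelyPrimeIdealSet P)
    {x y : S} (hx : x ∈ P) (hy : y ∉ P) : x + y ∉ P := by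
  intro h
  have := hP.2.1 _ h _ (hP.2.2.1 x hx (-1))
  simp only [neg_mul, one_mul, add_neg_cancel_comm] at this
  exact hy this

/-- Prime avoidance: a non-empty set closed under addition and multiplication which is contained
in none of finitely many completely prime ideals is not contained in their union. -/
theorem exists_mem_forall_notMem_of_isCompletelyPrimeIdealSet {ι : Type*} {P : ι → Set S}
    (hP : ∀ j, IsCompletelyPrimeIdealSet (P j)) {I : Set S} (hI : I.Nonempty)
    (h_add : ∀ x ∈ I, ∀ y ∈ I, x + y ∈ I) (h_mul : ∀ x ∈ I, ∀ y ∈ I, x * y ∈ I)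
    (hIP : ∀ j, ¬I ⊆ P j) (s : Finset ι) : ∃ x ∈ I, ∀ j ∈ s, x ∉ P j := by
  classical
  induction s using Finset.strongInduction with
  | H s ih =>
    rcases s.eq_empty_or_nonempty with rfl | ⟨a, ha⟩
    · obtain ⟨x, hx⟩ := hI
      exact ⟨x, hx, by simp⟩
    rcases (s.erase a).eq_empty_or_nonempty with hs | hs
    · obtain ⟨x, hx, hxa⟩ := Set.not_subset.1 (hIP a)
      refine ⟨x, hx, fun j hj => ?_⟩
      have : j = a := by
        by_contra hja
        simpa [hs] using Finset.mem_erase.2 ⟨hja, hj⟩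
      exact this ▸ hxa
    by_contra! hcon
    have key : ∀ j ∈ s, ∃ x ∈ I, x ∈ P j ∧ ∀ k ∈ s, k ≠ j → x ∉ P k := by
      intro j hj
      obtain ⟨x, hx, hxP⟩ := ih _ (Finset.erase_ssubset hj)
      have hxP' : ∀ k ∈ s, k ≠ j → x ∉ P k := fun k hk hkj =>
        hxP k (Finset.mem_erase.2 ⟨hkj, hk⟩)
      obtain ⟨k, hk, hxk⟩ := hcon x hx
      have hkj : k = j := by
        by_contra hkj
        exact hxP' k hk hkj hxk
      exact ⟨x, hx, hkj ▸ hxk, hxP'⟩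
    have prod : ∀ t : Finset ι, t.Nonempty → t ⊆ s.erase a →
        ∃ y ∈ I, y ∉ P a ∧ ∀ j ∈ t, y ∈ P j := by
      intro t ht
      induction ht using Finset.Nonempty.cons_induction with
      | singleton b =>
        intro hb
        obtain ⟨hba, hbs⟩ := Finset.mem_erase.1 (hb (Finset.mem_singleton_self b))
        obtain ⟨x, hx, hxb, hxk⟩ := key b hbs
        exact ⟨x, hx, hxk a ha hba.symm, by simpa using hxb⟩
      | cons b t hbt _ iht =>
        intro hb
        obtain ⟨hba, hbs⟩ := Finset.mem_erase.1 (hb (Finset.mem_cons_self b t))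
        obtain ⟨x, hx, hxb, hxk⟩ := key b hbs
        obtain ⟨y, hy, hya, hyt⟩ := iht fun j hj => hb (Finset.mem_cons_of_mem hj)
        refine ⟨x * y, h_mul x hx y hy, fun h => ?_, fun j hj => ?_⟩
        · exact ((hP a).2.2.2.2.2 x y h).elim (hxk a ha hba.symm) hya
        · rcases Finset.mem_cons.1 hj with rfl | hj
          · exact (hP j).2.2.2.1 x hxb y
          · exact (hP j).2.2.1 y (hyt j hj) x
    obtain ⟨y, hy, hya, hyt⟩ := prod _ hs subset_rfl
    obtain ⟨x, hx, hxa, hxk⟩ := key a ha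
    obtain ⟨k, hk, hxyk⟩ := hcon (x + y) (h_add x hx y hy)
    by_cases hka : k = a
    · subst hka
      exact (hP k).add_notMem hxa hya hxyk
    · refine (hP k).add_notMem (hyt k (Finset.mem_erase.2 ⟨hka, hk⟩)) (hxk k hk hka) ?_
      rwa [add_comm]

end CompletelyPrime

section ChainEnd

variable {R : Type u} [Ring R] {M : Type u} [AddCommGroup M] [Module R M] {n : ℕ}
  (c : Fin (n + 1) → Submodule R M)

/-- The map `chainDiag` to the endomorphism ring of the `i`-th factor, as a ring homomorphism. -/
def chainDiagRingHom (i : Fin n) : ChainEnd c →+* Module.End R (ChainFactor c i) where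
  toFun f := chainDiag c f i
  map_zero' := by ext x; rfl
  map_one' := by ext x; rfl
  map_add' f g := by ext x; rfl
  map_mul' f g := by ext x; rfl

variable {c}

theorem ChainEnd.mem_castSucc_of_injective {f : ChainEnd c} {i : Fin n}
    (hf : Function.Injective (chainDiag c f i)) {x : M} (hx : x ∈ c i.succ)
    (hfx : (f : Module.End R M) x ∈ c i.castSucc) : x ∈ c i.castSucc := by
  have h : chainDiag c f i (Submodule.Quotient.mk ⟨x, hx⟩) = 0 :=
    (Submodule.Quotient.mk_eq_zero _).2 hfx
  have hx' := (Submodule.Quotient.mk_eq_zero _).1 ((map_eq_zero_iff _ hf).1 h)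
  exact hx'

theorem ChainEnd.exists_sub_mem_castSucc_of_surjective {f : ChainEnd c} {i : Fin n}
    (hf : Function.Surjective (chainDiag c f i)) {y : M} (hy : y ∈ c i.succ) :
    ∃ x ∈ c i.succ, (f : Module.End R M) x - y ∈ c i.castSucc := by
  obtain ⟨q, hq⟩ := hf (Submodule.Quotient.mk ⟨y, hy⟩)
  obtain ⟨⟨x, hx⟩, rfl⟩ := Submodule.Quotient.mk_surjective _ q
  have hxy := (Submodule.Quotient.eq _).1 hq
  exact ⟨x, hx, hxy⟩

/-- A chain endomorphism inducing automorphisms on all factors is invertible. -/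
theorem ChainEnd.isUnit_of_bijective (hmono : Monotone c) (h0 : c 0 = ⊥)
    (hn : c (Fin.last n) = ⊤) {f : ChainEnd c}
    (hf : ∀ i, Function.Bijective (chainDiag c f i)) : IsUnit f := by
  have hinj : ∀ i, ∀ x ∈ c i, (f : Module.End R M) x = 0 → x = 0 := by
    intro i
    induction i using Fin.induction with
    | zero => intro x hx _; simpa [h0] using hx
    | succ i ih =>
      intro x hx hfx
      exact ih x (mem_castSucc_of_injective (hf i).1 hx (hfx ▸ zero_mem _)) hfx
  have hsurj : ∀ i, ∀ y ∈ c i, ∃ x ∈ c i, (f : Module.End R M) x = y := by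
    intro i
    induction i using Fin.induction with
    | zero =>
      intro y hy
      have : y = 0 := by simpa [h0] using hy
      exact ⟨0, zero_mem _, by simp [this]⟩
    | succ i ih =>
      intro y hy
      obtain ⟨x, hx, hxy⟩ := exists_sub_mem_castSucc_of_surjective (hf i).2 hy
      obtain ⟨z, hz, hzx⟩ := ih _ hxy
      exact ⟨x - z, sub_mem hx (hmono i.castSucc_le_succ hz), by simp [hzx]⟩
  have hbij : Function.Bijective (f : Module.End R M) := by
    refine ⟨(injective_iff_map_eq_zero _).2 fun x => hinj (Fin.last n) x (by simp [hn]),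
      fun y => ?_⟩
    obtain ⟨x, -, hx⟩ := hsurj (Fin.last n) y (by simp [hn])
    exact ⟨x, hx⟩
  let e := LinearEquiv.ofBijective (f : Module.End R M) hbij
  have he : ∀ x, e x = (f : Module.End R M) x := fun x => rfl
  let g : ChainEnd c := ⟨e.symm.toLinearMap, fun i y hy => by
    obtain ⟨x, hx, rfl⟩ := hsurj i y hy
    rw [← he]
    simpa using hx⟩
  refine ⟨⟨f, g, ?_, ?_⟩, rfl⟩
  · ext x
    exact e.apply_symm_apply x
  · ext x
    exact e.symm_apply_apply x

end ChainEnd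

/-- Let `M` have a chain of submodules `0 = c 0 ≤ ... ≤ c n = M` with all factors
non-zero uniserial. Then the `2n` sets `I_{M,i,m}` (chain endomorphisms whose `i`-th
induced map is not injective) and `I_{M,i,e}` (those whose `i`-th induced map is not
surjective) are two-sided completely prime ideals of `E_M`, and every proper right ideal
and every proper left ideal of `E_M` is contained in one of them. -/
theorem chainEnd_twon_completely_prime_ideals
    {R : Type u} [Ring R] {M : Type u} [AddCommGroup M] [Module R M] {n : ℕ}
    (c : Fin (n + 1) → Submodule R M) (hmono : Monotone c)
    (h0 : c 0 = ⊥) (hn : c (Fin.last n) = ⊤)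
    (hnz : ∀ i : Fin n, Nontrivial (ChainFactor c i))
    (huni : ∀ i : Fin n, IsUniserialModule R (ChainFactor c i)) :
    (∀ i : Fin n, IsCompletelyPrimeIdealSet
      {f : ChainEnd c | ¬Function.Injective (chainDiag c f i)}) ∧
    (∀ i : Fin n, IsCompletelyPrimeIdealSet
      {f : ChainEnd c | ¬Function.Surjective (chainDiag c f i)}) ∧
    (∀ I : Set (ChainEnd c), IsRightIdealSet I → I ≠ Set.univ →
      (∃ i : Fin n, I ⊆ {f : ChainEnd c | ¬Function.Injective (chainDiag c f i)}) ∨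
      (∃ i : Fin n, I ⊆ {f : ChainEnd c | ¬Function.Surjective (chainDiag c f i)})) ∧
    (∀ I : Set (ChainEnd c), IsLeftIdealSet I → I ≠ Set.univ →
      (∃ i : Fin n, I ⊆ {f : ChainEnd c | ¬Function.Injective (chainDiag c f i)}) ∨
      (∃ i : Fin n, I ⊆ {f : ChainEnd c | ¬Function.Surjective (chainDiag c f i)})) := by
  have hm : ∀ i : Fin n, IsCompletelyPrimeIdealSet
      {f : ChainEnd c | ¬Function.Injective (chainDiag c f i)} := fun i =>
    (huni i).isCompletelyPrimeIdealSet_not_injective.preimage (chainDiagRingHom c i)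
  have he : ∀ i : Fin n, IsCompletelyPrimeIdealSet
      {f : ChainEnd c | ¬Function.Surjective (chainDiag c f i)} := fun i =>
    (huni i).isCompletelyPrimeIdealSet_not_surjective.preimage (chainDiagRingHom c i)
  have avoid : ∀ I : Set (ChainEnd c), I.Nonempty → (∀ x ∈ I, ∀ y ∈ I, x + y ∈ I) →
      (∀ x ∈ I, ∀ y ∈ I, x * y ∈ I) → (∀ f ∈ I, ¬IsUnit f) →
      (∃ i : Fin n, I ⊆ {f : ChainEnd c | ¬Function.Injective (chainDiag c f i)}) ∨
      (∃ i : Fin n, I ⊆ {f : ChainEnd c | ¬Function.Surjective (chainDiag c f i)}) := by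
    intro I hI h_add h_mul h_unit
    by_contra! hcon
    obtain ⟨f, hf, hfP⟩ := exists_mem_forall_notMem_of_isCompletelyPrimeIdealSet
      (P := Sum.elim (fun i : Fin n => {f : ChainEnd c | ¬Function.Injective (chainDiag c f i)})
        (fun i : Fin n => {f : ChainEnd c | ¬Function.Surjective (chainDiag c f i)}))
      (Sum.rec hm he) hI h_add h_mul (Sum.rec hcon.1 hcon.2) Finset.univ
    exact h_unit f hf (ChainEnd.isUnit_of_bijective hmono h0 hn fun i =>
      ⟨not_not.1 (hfP (Sum.inl i) (Finset.mem_univ _)),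
        not_not.1 (hfP (Sum.inr i) (Finset.mem_univ _))⟩)
  refine ⟨hm, he, fun I hI hne => ?_, fun I hI hne => ?_⟩
  · refine avoid I ⟨0, hI.1⟩ hI.2.1 (fun x hx y _ => hI.2.2 x hx y) ?_
    rintro _ hf ⟨u, rfl⟩
    exact hne (Set.eq_univ_of_forall fun s => by simpa using hI.2.2 _ hf (↑u⁻¹ * s))
  · refine avoid I ⟨0, hI.1⟩ hI.2.1 (fun x _ y hy => hI.2.2 y hy x) ?_
    rintro _ hf ⟨u, rfl⟩
    exact hne (Set.eq_univ_of_forall fun s => by simpa using hI.2.2 _ hf (s * ↑u⁻¹))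
end

section
/- Let M and N be right R-modules each with a chain of n submodules with uniserial non-zero factors, and suppose [M]_{i,a} = [N]_{i,a} (same i-th monogeny class for a = m, or same i-th epigeny class for a = e). If moreover I_{M,j,b} ⊆ I_{M,i,a} in E_M, then [M]_{j,b} = [N]_{j,b}. -/
universe u

/-- `ClassCond true` is injectivity (the monogeny condition "m") and `ClassCond false`
is surjectivity (the epigeny condition "e"). -/
def ClassCond {R A B : Type*} [Ring R] [AddCommGroup A] [Module R A] [AddCommGroup B]
    [Module R B] (a : Bool) (φ : A →ₗ[R] B) : Prop :=
  if a then Function.Injective φ else Function.Surjective φ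

/-- Two chains `c` on `M` and `d` on `N` have the same `i`-th monogeny class
(`a = true`) resp. the same `i`-th epigeny class (`a = false`) if there are
chain morphisms `f : M → N` and `g : N → M` whose induced maps on the `i`-th factors
are both injective resp. both surjective. -/
def SameChainClass {R : Type u} [Ring R] {M N : Type u} [AddCommGroup M] [Module R M]
    [AddCommGroup N] [Module R N] {n : ℕ} (a : Bool)
    (c : Fin (n + 1) → Submodule R M) (d : Fin (n + 1) → Submodule R N) (i : Fin n) :
    Prop :=
  ∃ (f : M →ₗ[R] N) (hf : PreservesChain f c d) (g : N →ₗ[R] M)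
    (hg : PreservesChain g d c),
    ClassCond a (inducedHom f hf i) ∧ ClassCond a (inducedHom g hg i)

/-- If a composite of linear maps through a uniserial module is injective, with non-zero
domain, then both maps are injective; if it is surjective, with non-zero codomain, then both
maps are surjective. -/
theorem ClassCond.of_comp {R A B C : Type*} [Ring R] [AddCommGroup A] [Module R A]
    [AddCommGroup B] [Module R B] [AddCommGroup C] [Module R C] [Nontrivial A] [Nontrivial C]
    (hB : IsUniserialModule R B) {a : Bool} {φ : A →ₗ[R] B} {ψ : B →ₗ[R] C}
    (h : ClassCond a (ψ ∘ₗ φ)) : ClassCond a φ ∧ ClassCond a ψ := by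
  cases a with
  | true =>
    simp only [ClassCond, if_true] at h ⊢
    have hφ : Function.Injective φ := Function.Injective.of_comp h
    refine ⟨hφ, LinearMap.ker_eq_bot.mp ?_⟩
    rcases hB (LinearMap.range φ) (LinearMap.ker ψ) with hle | hle
    · obtain ⟨x, hx⟩ := exists_ne (0 : A)
      refine absurd (h ?_) hx
      simpa using hle (LinearMap.mem_range_self φ x)
    · refine (Submodule.eq_bot_iff _).mpr fun y hy => ?_
      obtain ⟨x, rfl⟩ := hle hy
      have hx : x = 0 := h (by simpa using hy)
      simp [hx]
  | false =>
    simp only [ClassCond, Bool.false_eq_true, if_false] at h ⊢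
    have hψ : Function.Surjective ψ := Function.Surjective.of_comp h
    refine ⟨LinearMap.range_eq_top.mp ?_, hψ⟩
    rcases hB (LinearMap.range φ) (LinearMap.ker ψ) with hle | hle
    · obtain ⟨z, hz⟩ := exists_ne (0 : C)
      obtain ⟨x, rfl⟩ := h z
      exact absurd (by simpa using hle (LinearMap.mem_range_self φ x)) hz
    · refine Submodule.eq_top_iff'.mpr fun y => ?_
      obtain ⟨x, hx⟩ := h (ψ y)
      have hmem : y - φ x ∈ LinearMap.range φ := hle (by simp_all)
      simpa using add_mem hmem (LinearMap.mem_range_self φ x)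

theorem ClassCond.comp {R A B C : Type*} [Ring R] [AddCommGroup A] [Module R A]
    [AddCommGroup B] [Module R B] [AddCommGroup C] [Module R C] {a : Bool}
    {φ : A →ₗ[R] B} {ψ : B →ₗ[R] C} (hψ : ClassCond a ψ) (hφ : ClassCond a φ) :
    ClassCond a (ψ ∘ₗ φ) := by
  cases a <;> simp only [ClassCond, Bool.false_eq_true, if_true, if_false] at *
  · simpa using hψ.comp hφ
  · simpa using hψ.comp hφ

theorem chainDiag_comp {R : Type u} [Ring R] {M N : Type u} [AddCommGroup M] [Module R M]
    [AddCommGroup N] [Module R N] {n : ℕ} {c : Fin (n + 1) → Submodule R M}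
    {d : Fin (n + 1) → Submodule R N} {f : M →ₗ[R] N} (hf : PreservesChain f c d)
    {g : N →ₗ[R] M} (hg : PreservesChain g d c) (i : Fin n) :
    chainDiag c ⟨g ∘ₗ f, fun k x hx => hg k _ (hf k x hx)⟩ i =
      inducedHom g hg i ∘ₗ inducedHom f hf i := by
  refine LinearMap.ext fun x => ?_
  induction x using Submodule.Quotient.induction_on with
  | _ x => rfl

/-- Let `M`, `N` carry chains of `n` submodules with non-zero uniserial factors, and
suppose `[M]_{i,a} = [N]_{i,a}`. If `I_{M,j,b} ⊆ I_{M,i,a}` in `E_M`, then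
`[M]_{j,b} = [N]_{j,b}`. -/
theorem sameChainClass_of_ideal_subset
    {R : Type u} [Ring R] {M N : Type u} [AddCommGroup M] [Module R M]
    [AddCommGroup N] [Module R N] {n : ℕ}
    (c : Fin (n + 1) → Submodule R M) (hcmono : Monotone c)
    (hc0 : c 0 = ⊥) (hcn : c (Fin.last n) = ⊤)
    (d : Fin (n + 1) → Submodule R N) (hdmono : Monotone d)
    (hd0 : d 0 = ⊥) (hdn : d (Fin.last n) = ⊤)
    (hcnz : ∀ i : Fin n, Nontrivial (ChainFactor c i))
    (hcuni : ∀ i : Fin n, IsUniserialModule R (ChainFactor c i))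
    (hdnz : ∀ i : Fin n, Nontrivial (ChainFactor d i))
    (hduni : ∀ i : Fin n, IsUniserialModule R (ChainFactor d i))
    (i j : Fin n) (a b : Bool)
    (hia : SameChainClass a c d i)
    (hsub : {f : ChainEnd c | ¬ClassCond b (chainDiag c f j)} ⊆
            {f : ChainEnd c | ¬ClassCond a (chainDiag c f i)}) :
    SameChainClass b c d j := by
  obtain ⟨f, hf, g, hg, hfi, hgi⟩ := hia
  have hj : ClassCond b (inducedHom g hg j ∘ₗ inducedHom f hf j) := by
    rw [← chainDiag_comp hf hg j]
    by_contra hnot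
    refine hsub hnot ?_
    rw [chainDiag_comp hf hg i]
    exact hgi.comp hfi
  have := hcnz j
  exact ⟨f, hf, g, hg, ClassCond.of_comp (hduni j) hj⟩
end
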